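/- arXiv:2312.09101 — 2 statements merged into one kernel-verified Lean document; each statement's English description precedes it below -/
import Mathlib

section
/- Let G = (X,E) be a finite connected graph without dead ends with cyclomatic number c(G) ≠ 1. Then every f ∈ E_1(Δᵉ; Maps(E,ℂ)) satisfies f(e) + f(ē) = 0 for every edge e ∈ E and Σ_{e ∈ E, ι(e) = x} f(e) = 0 for every vertex x ∈ X. -/
open Function Set
open scoped Classical

namespace GraphQCC

variable {X : Type} (G : SimpleGraph X)

/-- The set of directed edges of a (symmetric, loopless) graph. -/
abbrev DE := {p : X × X // G.Adj p.1 p.2}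

variable {G}

/-- Initial vertex of a directed edge. -/
def ini (e : DE G) : X := e.1.1

/-- Terminal vertex of a directed edge. -/
def ter (e : DE G) : X := e.1.2

/-- Opposite edge. -/
def op (e : DE G) : DE G := ⟨(e.1.2, e.1.1), e.2.symm⟩

variable (G)

/-- Degree of a vertex: the number of directed edges starting at it. -/
noncomputable def deg (x : X) : ℕ := Set.ncard {e : DE G | ini e = x}

/-- The graph is locally finite: every vertex has finite degree. -/
def LocFin : Prop := ∀ x : X, {e : DE G | ini e = x}.Finite

/-- The edge Laplacian. -/
noncomputable def edgeLap (f : DE G → ℂ) (e : DE G) : ℂ :=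
  ∑ᶠ e' ∈ {e' : DE G | ini e' = ter e ∧ e' ≠ op e}, f e'

/-- The `z`-eigenspace of the edge Laplacian, as a set of functions on directed edges. -/
def edgeEig (z : ℂ) : Set (DE G → ℂ) := {f | ∀ e, edgeLap G f e = z * f e}

/-- The edge inversion operator Ξ. -/
def Xi (f : DE G → ℂ) (e : DE G) : ℂ := f (op e)

/-- The operator Σ (sum over edges with the same initial point). -/
noncomputable def Sig (f : DE G → ℂ) (e : DE G) : ℂ :=
  ∑ᶠ e' ∈ {e' : DE G | ini e' = ini e}, f e'

/-- Edges pointing away from a vertex `o`. -/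
def away (o : X) : Set (DE G) := {e | G.dist o (ter e) = G.dist o (ini e) + 1}

/-- The edge Laplacian on functions on the edges pointing away from `o`. -/
noncomputable def edgeLapAway (o : X) (f : ↥(away G o) → ℂ) (e : ↥(away G o)) : ℂ :=
  ∑ᶠ e' ∈ {e' : ↥(away G o) | ini e'.1 = ter e.1 ∧ e'.1 ≠ op e.1}, f e'

/-- The `z`-eigenspace of the edge Laplacian on edges pointing away from `o`. -/
def edgeEigAway (o : X) (z : ℂ) : Set (↥(away G o) → ℂ) :=
  {f | ∀ e, edgeLapAway G o f e = z * f e}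

/-! ## Boundary at infinity -/

/-- A ray: an infinite non-backtracking chain of vertices. -/
def IsRay (r : ℕ → X) : Prop := (∀ n, G.Adj (r n) (r (n + 1))) ∧ ∀ n, r (n + 2) ≠ r n

abbrev Ray := {r : ℕ → X // IsRay G r}

/-- Two rays are equivalent if they share infinitely many vertices. -/
def RayRel (r r' : Ray G) : Prop := (Set.range r.1 ∩ Set.range r'.1).Infinite

/-- The boundary at infinity: equivalence classes of rays. -/
def Boundary := Quot (RayRel G)

/-- The set `∂₊ e` of boundary points reachable by a non-backtracking chain starting with `e`. -/
def plusBd (e : DE G) : Set (Boundary G) :=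
  {ω | ∃ r : Ray G, Quot.mk (RayRel G) r = ω ∧ r.1 0 = ini e ∧ r.1 1 = ter e}

/-- The topology on the boundary generated by the sets `∂₊ e`. -/
instance : TopologicalSpace (Boundary G) :=
  TopologicalSpace.generateFrom {s | ∃ e : DE G, s = plusBd G e}

/-- The space of locally constant functions on the boundary. -/
noncomputable def Clc : Submodule ℂ (Boundary G → ℂ) where
  carrier := {f | IsLocallyConstant f}
  add_mem' hf hg := hf.comp₂ hg (· + ·)
  zero_mem' := IsLocallyConstant.const 0
  smul_mem' c f hf := hf.comp (c * ·)

/-- `D'(Ω)`: the algebraic dual of the space of locally constant functions on the boundary. -/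
abbrev DualB := Module.Dual ℂ ↥(Clc G)

/-- Pairing of a functional on `C^lc(Ω)` with a function on the boundary. -/
noncomputable def pairB (μ : DualB G) (g : Boundary G → ℂ) : ℂ :=
  if h : IsLocallyConstant g then μ ⟨g, h⟩ else 0

/-- The horocycle bracket `⟨x, ω⟩` with respect to the base point `o`: the unique integer `k`
such that `d(x, r n) = n - k` for every ray `r` from `o` representing `ω` and all large `n`. -/
noncomputable def horo (o x : X) (ω : Boundary G) : ℤ :=
  if h : ∃ k : ℤ, ∀ r : Ray G, Quot.mk (RayRel G) r = ω → r.1 0 = o →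
      ∃ N : ℕ, ∀ n : ℕ, N ≤ n → (G.dist x (r.1 n) : ℤ) = (n : ℤ) - k
  then h.choose else 0

/-- The scalar Poisson transform. -/
noncomputable def poisson (o : X) (z : ℂ) (μ : DualB G) (x : X) : ℂ :=
  pairB G μ fun ω => z ^ horo G o x ω

/-- The edge Poisson transform. -/
noncomputable def edgePoisson (o : X) (z : ℂ) (μ : DualB G) (e : DE G) : ℂ :=
  pairB G μ fun ω => z ^ horo G o (ini e) ω * Set.indicator (plusBd G e) 1 ω

/-! ## The shift space of non-backtracking chains of edges -/

/-- An infinite concatenated non-backtracking sequence of directed edges. -/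
def IsChainSeq (c : ℕ → DE G) : Prop :=
  ∀ i, ter (c i) = ini (c (i + 1)) ∧ ter (c (i + 1)) ≠ ini (c i)

/-- The shift space `𝔓`. -/
abbrev ChainSp := {c : ℕ → DE G // IsChainSeq G c}

/-- The one-sided shift on chains. -/
def shift (c : ChainSp G) : ChainSp G := ⟨fun n => c.1 (n + 1), fun i => c.2 (i + 1)⟩

/-- The district (cylinder) topology on the shift space. -/
instance : TopologicalSpace (ChainSp G) :=
  TopologicalSpace.generateFrom
    {s | ∃ (c₀ : ChainSp G) (n : ℕ), s = {c : ChainSp G | ∀ i ≤ n, c.1 i = c₀.1 i}}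

/-- The Ruelle transfer operator. -/
noncomputable def transfer (F : ChainSp G → ℂ) (c : ChainSp G) : ℂ :=
  ∑ᶠ c' ∈ {c' : ChainSp G | shift G c' = c}, F c'

/-- Functions on chains depending only on the first `N` edges. -/
def cylFun (N : ℕ) : Set (ChainSp G → ℂ) :=
  {F | ∀ c c' : ChainSp G, (∀ i < N, c.1 i = c'.1 i) → F c = F c'}

/-- The ray of initial vertices of a chain of edges. -/
def toRay (c : ChainSp G) : Ray G :=
  ⟨fun n => ini (c.1 n), by
    refine ⟨fun n => ?_, fun n => ?_⟩
    · have h1 : ter (c.1 n) = ini (c.1 (n + 1)) := (c.2 n).1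
      have h2 : G.Adj (ini (c.1 n)) (ter (c.1 n)) := (c.1 n).2
      rwa [h1] at h2
    · have h1 : ter (c.1 (n + 1)) = ini (c.1 (n + 2)) := (c.2 (n + 1)).1
      have h2 : ter (c.1 (n + 1)) ≠ ini (c.1 n) := (c.2 n).2
      rwa [h1] at h2⟩

/-- The endpoint map `B : 𝔓 → Ω`. -/
def endB (c : ChainSp G) : Boundary G := Quot.mk (RayRel G) (toRay G c)

/-- The pushforward `B_⋆` by fiber summation. -/
noncomputable def push (f : ChainSp G → ℂ) (ω : Boundary G) : ℂ :=
  ∑ᶠ c ∈ {c : ChainSp G | endB G c = ω}, f c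

/-- The space of locally constant compactly supported functions on the shift space. -/
noncomputable def CcP : Submodule ℂ (ChainSp G → ℂ) where
  carrier := {F | IsLocallyConstant F ∧ HasCompactSupport F}
  add_mem' hf hg := ⟨hf.1.comp₂ hg.1 (· + ·), hf.2.add hg.2⟩
  zero_mem' := ⟨IsLocallyConstant.const 0, HasCompactSupport.zero⟩
  smul_mem' c f hf := ⟨hf.1.comp (c * ·),
    hf.2.mono fun x hx h0 => hx (by simp [h0])⟩

/-- `D'(𝔓)`: the algebraic dual of `C^lc_c(𝔓)`. -/
abbrev DualP := Module.Dual ℂ ↥(CcP G)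

/-- Pairing of a functional on `C^lc_c(𝔓)` with a function on the shift space. -/
noncomputable def pairP (lam : DualP G) (g : ChainSp G → ℂ) : ℂ :=
  if h : g ∈ CcP G then lam ⟨g, h⟩ else 0

/-- The space of locally constant functions on the shift space (for finite graphs this is
`C^lc_c(𝔓)` since `𝔓` is compact). -/
noncomputable def ClcP : Submodule ℂ (ChainSp G → ℂ) where
  carrier := {F | IsLocallyConstant F}
  add_mem' hf hg := hf.comp₂ hg (· + ·)
  zero_mem' := IsLocallyConstant.const 0
  smul_mem' c f hf := hf.comp (c * ·)

/-- The dual of `C^lc(𝔓)`. -/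
abbrev DualPc := Module.Dual ℂ ↥(ClcP G)

/-- Pairing of a functional on `C^lc(𝔓)` with a function on the shift space. -/
noncomputable def pairPc (lam : DualPc G) (g : ChainSp G → ℂ) : ℂ :=
  if h : IsLocallyConstant g then lam ⟨g, h⟩ else 0

/-! ## Vertex Laplacian -/

/-- The vertex Laplacian (averaging over neighbors). -/
noncomputable def vertexLap (f : X → ℂ) (x : X) : ℂ :=
  ((deg G x : ℂ))⁻¹ * ∑ᶠ e ∈ {e : DE G | ini e = x}, f (ter e)

/-- The function `χ(z)(x) = (z + q_x z⁻¹)/(q_x + 1)`. -/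
noncomputable def chi (z : ℂ) (x : X) : ℂ :=
  (z + ((deg G x : ℂ) - 1) * z⁻¹) / (deg G x : ℂ)

/-- The `χ(z)`-eigenspace of the vertex Laplacian. -/
def vertexEig (z : ℂ) : Set (X → ℂ) := {f | ∀ x, vertexLap G f x = chi G z x * f x}

/-! ## Miscellaneous -/

/-- Two subsets of complex vector spaces (in practice: subspaces) are linearly isomorphic. -/
def AreLinIso {M N : Type} [AddCommMonoid M] [Module ℂ M] [AddCommMonoid N] [Module ℂ N]
    (A : Set M) (B : Set N) : Prop :=
  ∃ F : M → N, Set.BijOn F A B ∧ (∀ a ∈ A, ∀ b ∈ A, F (a + b) = F a + F b) ∧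
    ∀ (c : ℂ), ∀ a ∈ A, F (c • a) = c • F a

/-- The `z`-eigenspace of the edge Laplacian as a submodule (for a locally finite graph). -/
noncomputable def edgeEigSub (hlf : LocFin G) (z : ℂ) : Submodule ℂ (DE G → ℂ) where
  carrier := edgeEig G z
  add_mem' := by
    intro f g hf hg e
    have hS : {e' : DE G | ini e' = ter e ∧ e' ≠ op e}.Finite :=
      (hlf (ter e)).subset fun _ h => h.1
    have : edgeLap G (f + g) e = edgeLap G f e + edgeLap G g e := by
      simpa [edgeLap] using finsum_mem_add_distrib (f := f) (g := g) hS
    rw [this, hf e, hg e, Pi.add_apply, mul_add]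
  zero_mem' := by
    intro e
    simp [edgeLap]
  smul_mem' := by
    intro c f hf e
    have hS : {e' : DE G | ini e' = ter e ∧ e' ≠ op e}.Finite :=
      (hlf (ter e)).subset fun _ h => h.1
    have : edgeLap G (c • f) e = c * edgeLap G f e := by
      simp only [edgeLap, Pi.smul_apply, smul_eq_mul]
      rw [finsum_mem_eq_finite_toFinset_sum _ hS, finsum_mem_eq_finite_toFinset_sum _ hS,
        Finset.mul_sum]
    rw [Pi.smul_apply, smul_eq_mul, this, hf e]; ring

/-- The cyclomatic number of a finite graph, as an integer. -/
noncomputable def cyclo : ℤ := (Nat.card G.edgeSet : ℤ) - (Nat.card X : ℤ) + 1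

/-- 2-colorability. -/
def TwoColorable : Prop := ∃ col : X → Bool, ∀ x y : X, G.Adj x y → col x ≠ col y

/-- The sum of the values of `f` over the edges leaving a vertex. -/
noncomputable def outSum (f : DE G → ℂ) (x : X) : ℂ := ∑ᶠ e ∈ {e : DE G | ini e = x}, f e

theorem op_op (e : DE G) : op (op e) = e := rfl

theorem edgeLap_add_op [Finite X] (f : DE G → ℂ) (e : DE G) :
    edgeLap G f e + f (op e) = outSum G f (ter e) := by
  have hins : {e' : DE G | ini e' = ter e} =
      insert (op e) {e' : DE G | ini e' = ter e ∧ e' ≠ op e} := by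
    ext e'
    simp only [Set.mem_insert_iff, Set.mem_ofPred_eq]
    constructor
    · intro h
      by_cases h' : e' = op e
      · exact Or.inl h'
      · exact Or.inr ⟨h, h'⟩
    · rintro (rfl | h)
      · rfl
      · exact h.1
  rw [outSum, hins, finsum_mem_insert f (fun h => h.2 rfl) (Set.toFinite _), edgeLap, add_comm]

theorem card_directedEdge [Finite X] : Nat.card (DE G) = 2 * Nat.card G.edgeSet := by
  have := Fintype.ofFinite X
  let φ : DE G ≃ G.Dart :=
    { toFun := fun e => ⟨e.1, e.2⟩
      invFun := fun d => ⟨d.toProd, d.adj⟩ }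
  rw [Nat.card_congr φ, Nat.card_eq_fintype_card, G.dart_card_eq_twice_card_edges,
    Nat.card_eq_fintype_card, SimpleGraph.edgeFinset_card]

theorem sum_outSum [Fintype X] (f : DE G → ℂ) : ∑ x, outSum G f x = ∑ e, f e := by
  rw [← Finset.sum_fiberwise Finset.univ ini f]
  refine Finset.sum_congr rfl fun x _ => ?_
  rw [outSum, finsum_mem_eq_finite_toFinset_sum _ (Set.toFinite _)]
  exact Finset.sum_congr (by ext; simp) fun _ _ => rfl

theorem sum_op [Fintype X] (f : DE G → ℂ) : ∑ e, f (op e) = ∑ e, f e :=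
  Equiv.sum_comp (Function.Involutive.toPerm op (op_op G)) f

/-- If the outgoing sums of `f` and the sums over opposite pairs of edges are all equal to one
constant, double counting forces this constant to vanish unless `c(G) = 1`. -/
theorem eq_zero_of_outSum_eq [Finite X] (hc : cyclo G ≠ 1) {f : DE G → ℂ} {s : ℂ}
    (hout : ∀ x, outSum G f x = s) (hop : ∀ e, f e + f (op e) = s) : s = 0 := by
  have := Fintype.ofFinite X
  have h₁ : (Nat.card X : ℂ) * s = ∑ e, f e := by
    rw [← sum_outSum, Finset.sum_congr rfl fun x _ => hout x]
    simp
  have h₂ : (Nat.card (DE G) : ℂ) * s = 2 * ∑ e, f e := by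
    have h : ∑ e, (f e + f (op e)) = ∑ _e : DE G, s := Finset.sum_congr rfl fun e _ => hop e
    rw [Finset.sum_add_distrib, sum_op, Finset.sum_const, Finset.card_univ, nsmul_eq_mul,
      ← Nat.card_eq_fintype_card] at h
    rw [← h, two_mul]
  rw [card_directedEdge] at h₂
  push_cast at h₂
  have h₃ : ((Nat.card G.edgeSet : ℂ) - Nat.card X) * s = 0 := by
    linear_combination h₂ / 2 - h₁
  refine (mul_eq_zero.mp h₃).resolve_left fun h => hc ?_
  have h' : (Nat.card G.edgeSet : ℤ) - Nat.card X = 0 := by exact_mod_cast h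
  rw [cyclo, h', zero_add]

/-- If `c(G) ≠ 1`, every `1`-eigenfunction of the edge Laplacian sums to
zero over each opposite pair of edges and over the edges leaving any vertex. -/
theorem statement16 {X : Type} [Finite X] (G : SimpleGraph X) (hconn : G.Connected)
    (hnd : ∀ x : X, 2 ≤ deg G x) (hc : cyclo G ≠ 1) :
    ∀ f ∈ edgeEig G 1, (∀ e : DE G, f e + f (op e) = 0) ∧
      ∀ x : X, ∑ᶠ e ∈ {e : DE G | ini e = x}, f e = 0 := by
  intro f hf
  have hter (e : DE G) : f e + f (op e) = outSum G f (ter e) := by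
    rw [← edgeLap_add_op, hf e, one_mul]
  have hadj {x y : X} (h : G.Adj x y) : outSum G f x = outSum G f y := by
    have h₁ := hter ⟨(x, y), h⟩
    have h₂ := hter (op ⟨(x, y), h⟩)
    rw [op_op, add_comm] at h₂
    exact h₂.symm.trans h₁
  have hconst (x y : X) : outSum G f x = outSum G f y := by
    obtain ⟨w⟩ := hconn.preconnected x y
    induction w with
    | nil => rfl
    | cons h _ ih => exact (hadj h).trans ih
  have hzero (x : X) : outSum G f x = 0 :=
    eq_zero_of_outSum_eq G hc (fun y => hconst y x)
      fun e => (hter e).trans (hconst (ter e) x)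
  exact ⟨fun e => (hter e).trans (hzero _), hzero⟩

end GraphQCC
end

section
/- Let G = (X,E) be a (q+1)-regular tree with q ≥ 1 and z ∈ ℂ ∖ {0}. Then for every μ ∈ D'(Ω) the following identities hold in Maps(E,ℂ), where (P_z μ ∘ ι)(e) := P_z μ(ι(e)): (1) Δᵉ(P^e_z μ) = z·P^e_z μ; (2) Ξ(P^e_z μ) = z^{−1}·(P_z μ ∘ ι) − z^{−1}·P^e_z μ; (3) Ξ(P_z μ ∘ ι) = z^{−1}·(P_z μ ∘ ι) + (z − z^{−1})·P^e_z μ; (4) Δᵉ(P_z μ ∘ ι) = q·z^{−1}·(P_z μ ∘ ι) + q·(z − z^{−1})·P^e_z μ. -/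
open Function Set
open scoped Classical

namespace GraphQCC

variable {X : Type} (G : SimpleGraph X)

variable {G}

variable (G)

section BoundaryTree

variable {G}

theorem eq_of_adj_of_dist_eq_add_one (hT : G.IsTree) {x u v w : X} (hu : G.Adj u w)
    (hv : G.Adj v w) (hdu : G.dist x w = G.dist x u + 1) (hdv : G.dist x w = G.dist x v + 1) :
    u = v := by
  have key : ∀ {u : X}, G.Adj u w → G.dist x w = G.dist x u + 1 →
      ∃ p : G.Walk x w, p.IsPath ∧ p.penultimate = u := by
    intro u hu hd
    obtain ⟨p, hp⟩ := (hT.connected x u).exists_walk_length_eq_dist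
    refine ⟨p.concat hu, SimpleGraph.Walk.isPath_of_length_eq_dist _ ?_, by simp⟩
    rw [SimpleGraph.Walk.length_concat, hp, hd]
  obtain ⟨p, hp, rfl⟩ := key hu hdu
  obtain ⟨p', hp', rfl⟩ := key hv hdv
  rw [(hT.existsUnique_path x w).unique hp hp']

theorem Ray.dist_apply_zero (hT : G.IsTree) (r : Ray G) (n : ℕ) :
    G.dist (r.1 0) (r.1 n) = n := by
  suffices h : G.dist (r.1 0) (r.1 n) = n ∧ G.dist (r.1 0) (r.1 (n + 1)) = n + 1 from h.1
  induction n with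
  | zero => simpa using r.2.1 0
  | succ n ih =>
    refine ⟨ih.2, ?_⟩
    rcases hT.dist_eq_dist_add_one_of_adj (r.1 0) (r.2.1 (n + 1)) with h | h
    · exact absurd (eq_of_adj_of_dist_eq_add_one hT (r.2.1 (n + 1)).symm (r.2.1 n) h (by omega))
        (r.2.2 n)
    · omega

theorem Ray.injective (hT : G.IsTree) (r : Ray G) : Injective r.1 := by
  intro m n h
  rw [← Ray.dist_apply_zero hT r m, h, Ray.dist_apply_zero hT r n]

/-- The ray obtained by dropping the first vertex. -/
def Ray.tail (r : Ray G) : Ray G :=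
  ⟨fun n => r.1 (n + 1), fun n => r.2.1 (n + 1), fun n => r.2.2 (n + 1)⟩

/-- The ray obtained by adding a vertex in front. -/
def Ray.cons (r : Ray G) (x : X) (hx : G.Adj x (r.1 0)) (hne : r.1 1 ≠ x) : Ray G :=
  ⟨fun n => Nat.casesOn n x r.1, by
    refine ⟨fun n => ?_, fun n => ?_⟩
    · cases n with
      | zero => exact hx
      | succ n => exact r.2.1 n
    · cases n with
      | zero => exact hne
      | succ n => exact r.2.2 n⟩

theorem rayRel_of_eventually_eq (hT : G.IsTree) {r r' : Ray G} (a b : ℕ)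
    (h : ∀ n, r.1 (n + a) = r'.1 (n + b)) : RayRel G r r' := by
  have hinj : Injective fun n => r.1 (n + a) :=
    (Ray.injective hT r).comp (add_left_injective a)
  refine (Set.infinite_range_of_injective hinj).mono ?_
  rintro _ ⟨n, rfl⟩
  exact ⟨⟨n + a, rfl⟩, ⟨n + b, (h n).symm⟩⟩

theorem Ray.mk_tail (hT : G.IsTree) (r : Ray G) :
    Quot.mk (RayRel G) r.tail = Quot.mk (RayRel G) r :=
  Quot.sound (rayRel_of_eventually_eq hT 0 1 fun _ => rfl)

theorem Ray.mk_cons (hT : G.IsTree) (r : Ray G) (x : X) (hx : G.Adj x (r.1 0))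
    (hne : r.1 1 ≠ x) : Quot.mk (RayRel G) (r.cons x hx hne) = Quot.mk (RayRel G) r :=
  Quot.sound (rayRel_of_eventually_eq hT 1 0 fun _ => rfl)

theorem exists_ray_eventually_eq (hT : G.IsTree) (r : Ray G) (x : X) :
    ∃ r' : Ray G, r'.1 0 = x ∧ ∃ a b, ∀ n, r'.1 (n + a) = r.1 (n + b) := by
  obtain ⟨p⟩ := hT.connected x (r.1 0)
  generalize hy : r.1 0 = y at p
  induction p with
  | nil => exact ⟨r, hy, 0, 0, fun _ => rfl⟩
  | @cons x _ _ h p ih =>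
    obtain ⟨s, hs, a, b, hab⟩ := ih hy
    subst hs
    by_cases hx : s.1 1 = x
    · refine ⟨s.tail, hx, a, b + 1, fun n => ?_⟩
      have := hab (n + 1)
      rw [show n + (b + 1) = n + 1 + b by omega, ← this, show n + 1 + a = n + a + 1 by omega]
      rfl
    · exact ⟨s.cons x h hx, rfl, a + 1, b, hab⟩

theorem Boundary.exists_ray (hT : G.IsTree) (ω : Boundary G) (x : X) :
    ∃ r : Ray G, Quot.mk (RayRel G) r = ω ∧ r.1 0 = x := by
  induction ω using Quot.ind with
  | mk r =>
    obtain ⟨r', h0, a, b, hab⟩ := exists_ray_eventually_eq hT r x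
    exact ⟨r', Quot.sound (rayRel_of_eventually_eq hT a b hab), h0⟩

/-- The difference of the distances from `x` and `y` to the vertices of the ray `r` is
eventually equal to `k`. -/
def IsBusemann (x y : X) (k : ℤ) (r : Ray G) : Prop :=
  ∃ N : ℕ, ∀ n : ℕ, N ≤ n → (G.dist x (r.1 n) : ℤ) - G.dist y (r.1 n) = k

theorem exists_dist_eq_sub (hT : G.IsTree) (r : Ray G) (x : X) :
    ∃ k : ℤ, ∃ N : ℕ, ∀ n : ℕ, N ≤ n → (G.dist x (r.1 n) : ℤ) = n - k := by
  obtain ⟨r', rfl, a, b, hab⟩ := exists_ray_eventually_eq hT r x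
  refine ⟨b - a, b, fun n hn => ?_⟩
  obtain ⟨m, rfl⟩ := Nat.exists_eq_add_of_le' hn
  rw [← hab, Ray.dist_apply_zero hT]
  push_cast
  ring

theorem exists_isBusemann (hT : G.IsTree) (x y : X) (r : Ray G) :
    ∃ k : ℤ, IsBusemann x y k r := by
  obtain ⟨k, N, hN⟩ := exists_dist_eq_sub hT r x
  obtain ⟨l, M, hM⟩ := exists_dist_eq_sub hT r y
  refine ⟨l - k, max N M, fun n hn => ?_⟩
  rw [hN n (le_trans (le_max_left _ _) hn), hM n (le_trans (le_max_right _ _) hn)]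
  ring

theorem RayRel.symm {r r' : Ray G} (h : RayRel G r r') : RayRel G r' r := by
  unfold RayRel at h ⊢
  rwa [Set.inter_comm]

theorem IsBusemann.of_rayRel (hT : G.IsTree) {x y : X} {k : ℤ} {r r' : Ray G}
    (hrel : RayRel G r r') (h : IsBusemann x y k r) : IsBusemann x y k r' := by
  obtain ⟨l, hl⟩ := exists_isBusemann hT x y r'
  suffices k = l by rwa [this]
  obtain ⟨N, hN⟩ := h
  obtain ⟨M, hM⟩ := hl
  have hfin : (r.1 '' Set.Iio N ∪ r'.1 '' Set.Iio M).Finite :=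
    ((Set.finite_Iio N).image _).union ((Set.finite_Iio M).image _)
  obtain ⟨v, ⟨⟨n, rfl⟩, ⟨m, hm⟩⟩, hv⟩ := (hrel.sdiff hfin).nonempty
  have hn : N ≤ n := by
    by_contra hlt
    exact hv (Or.inl ⟨n, not_le.mp hlt, rfl⟩)
  have hm' : M ≤ m := by
    by_contra hlt
    exact hv (Or.inr ⟨m, not_le.mp hlt, hm⟩)
  rw [← hN n hn, ← hM m hm', hm]

theorem isBusemann_of_mk_eq (hT : G.IsTree) {x y : X} {k : ℤ} {r r' : Ray G}
    (hmk : Quot.mk (RayRel G) r = Quot.mk (RayRel G) r') (h : IsBusemann x y k r) :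
    IsBusemann x y k r' := by
  have hlift := congrArg (Quot.lift (IsBusemann x y k) fun _ _ hrel =>
    propext ⟨.of_rayRel hT hrel, .of_rayRel hT hrel.symm⟩) hmk
  exact cast hlift h

theorem IsBusemann.unique {x y : X} {k l : ℤ} {r : Ray G} (hk : IsBusemann x y k r)
    (hl : IsBusemann x y l r) : k = l := by
  obtain ⟨N, hN⟩ := hk
  obtain ⟨M, hM⟩ := hl
  rw [← hN (max N M) (le_max_left _ _), ← hM (max N M) (le_max_right _ _)]

theorem IsBusemann.sub {x y w : X} {k l : ℤ} {r : Ray G} (hk : IsBusemann x y k r)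
    (hl : IsBusemann x w l r) : IsBusemann w y (k - l) r := by
  obtain ⟨N, hN⟩ := hk
  obtain ⟨M, hM⟩ := hl
  refine ⟨max N M, fun n hn => ?_⟩
  rw [← hN n (le_trans (le_max_left _ _) hn), ← hM n (le_trans (le_max_right _ _) hn)]
  ring

theorem isBusemann_zero_one (hT : G.IsTree) (r : Ray G) :
    IsBusemann (r.1 0) (r.1 1) 1 r := by
  refine ⟨1, fun n hn => ?_⟩
  obtain ⟨m, rfl⟩ := Nat.exists_eq_add_of_le' hn
  have h : G.dist (r.1 1) (r.1 (m + 1)) = m := Ray.dist_apply_zero hT r.tail m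
  rw [Ray.dist_apply_zero hT, h]
  push_cast
  ring

theorem isBusemann_horo (hT : G.IsTree) (o x : X) (r : Ray G) :
    IsBusemann o x (horo G o x (Quot.mk (RayRel G) r)) r := by
  have hex : ∃ k : ℤ, ∀ s : Ray G, Quot.mk (RayRel G) s = Quot.mk (RayRel G) r → s.1 0 = o →
      ∃ N : ℕ, ∀ n : ℕ, N ≤ n → (G.dist x (s.1 n) : ℤ) = (n : ℤ) - k := by
    obtain ⟨k, hk⟩ := exists_isBusemann hT o x r
    refine ⟨k, fun s hs h0 => ?_⟩
    obtain ⟨N, hN⟩ := isBusemann_of_mk_eq hT hs.symm hk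
    refine ⟨N, fun n hn => ?_⟩
    rw [← hN n hn, ← h0, Ray.dist_apply_zero hT]
    ring
  obtain ⟨s, hs, h0⟩ := Boundary.exists_ray hT (Quot.mk (RayRel G) r) o
  refine isBusemann_of_mk_eq hT hs ?_
  obtain ⟨N, hN⟩ := hex.choose_spec s hs h0
  refine ⟨N, fun n hn => ?_⟩
  have hdist : G.dist o (s.1 n) = n := h0 ▸ Ray.dist_apply_zero hT s n
  rw [show horo G o x (Quot.mk (RayRel G) r) = hex.choose from dif_pos hex, hN n hn, hdist]
  ring

theorem horo_self (hT : G.IsTree) (o : X) (ω : Boundary G) : horo G o o ω = 0 := by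
  induction ω using Quot.ind with
  | mk r => exact (isBusemann_horo hT o o r).unique ⟨0, fun n _ => sub_self _⟩

theorem mem_plusBd_op_iff (hT : G.IsTree) (e : DE G) (ω : Boundary G) :
    ω ∈ plusBd G (op e) ↔ ω ∉ plusBd G e := by
  constructor
  · rintro ⟨r, rfl, hr0, hr1⟩ ⟨s, hs, hs0, hs1⟩
    have h1 := isBusemann_zero_one hT r
    have h2 := isBusemann_of_mk_eq hT hs (isBusemann_zero_one hT s)
    rw [hr0, hr1] at h1
    rw [hs0, hs1] at h2
    obtain ⟨N, hN⟩ := h1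
    obtain ⟨M, hM⟩ := h2
    have h4 := hN (max N M) (le_max_left _ _)
    have h5 := hM (max N M) (le_max_right _ _)
    simp only [ini, ter, op] at h4 h5
    omega
  · intro hω
    obtain ⟨r, rfl, h0⟩ := Boundary.exists_ray hT ω (ini e)
    have hne : r.1 1 ≠ ter e := fun h1 => hω ⟨r, rfl, h0, h1⟩
    exact ⟨r.cons (ter e) (h0 ▸ e.2.symm) hne, r.mk_cons hT _ _ _, rfl, h0⟩

theorem horo_ter_of_mem (hT : G.IsTree) (o : X) {e : DE G} {ω : Boundary G}
    (hω : ω ∈ plusBd G e) : horo G o (ter e) ω = horo G o (ini e) ω + 1 := by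
  obtain ⟨r, rfl, h0, h1⟩ := hω
  have h := (isBusemann_horo hT o (ter e) r).sub (isBusemann_horo hT o (ini e) r)
  have h' := isBusemann_zero_one hT r
  rw [h0, h1] at h'
  have := h.unique h'
  omega

theorem horo_ter_of_notMem (hT : G.IsTree) (o : X) {e : DE G} {ω : Boundary G}
    (hω : ω ∉ plusBd G e) : horo G o (ter e) ω = horo G o (ini e) ω - 1 :=
  eq_sub_of_add_eq (horo_ter_of_mem hT o ((mem_plusBd_op_iff hT e ω).2 hω)).symm

theorem plusBd_subset (hT : G.IsTree) {e e' : DE G} (hini : ini e' = ter e) (hne : e' ≠ op e) :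
    plusBd G e' ⊆ plusBd G e := by
  rintro _ ⟨r, rfl, h0, h1⟩
  have hne' : r.1 1 ≠ ini e := fun h =>
    hne (Subtype.ext (Prod.ext hini (h1.symm.trans h)))
  rw [hini] at h0
  exact ⟨r.cons (ini e) (h0 ▸ e.2) hne', r.mk_cons hT _ _ _, rfl, h0⟩

theorem exists_mem_plusBd (hT : G.IsTree) {e : DE G} {ω : Boundary G} (hω : ω ∈ plusBd G e) :
    ∃ e' : DE G, (ini e' = ter e ∧ e' ≠ op e) ∧ ω ∈ plusBd G e' := by
  obtain ⟨r, rfl, h0, h1⟩ := hω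
  refine ⟨⟨(r.1 1, r.1 2), r.2.1 1⟩, ⟨h1, fun h => ?_⟩, r.tail, r.mk_tail hT, rfl, rfl⟩
  exact r.2.2 0 ((congrArg ter h).trans h0.symm)

theorem eq_of_mem_plusBd (hT : G.IsTree) {e e' : DE G} {ω : Boundary G} (hini : ini e = ini e')
    (h : ω ∈ plusBd G e) (h' : ω ∈ plusBd G e') : e = e' := by
  by_contra hne
  exact (mem_plusBd_op_iff hT e' ω).1 (plusBd_subset hT (e := op e') hini hne h) h'

theorem isClopen_plusBd (hT : G.IsTree) (e : DE G) : IsClopen (plusBd G e) := by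
  have hopen : ∀ e : DE G, IsOpen (plusBd G e) := fun e =>
    TopologicalSpace.isOpen_generateFrom_of_mem ⟨e, rfl⟩
  refine ⟨⟨?_⟩, hopen e⟩
  rw [show (plusBd G e)ᶜ = plusBd G (op e) from
    Set.ext fun ω => (mem_plusBd_op_iff hT e ω).symm]
  exact hopen (op e)

theorem isLocallyConstant_indicator_plusBd (hT : G.IsTree) (e : DE G) :
    IsLocallyConstant ((plusBd G e).indicator (1 : Boundary G → ℂ)) :=
  ((LocallyConstant.const (Boundary G) (1 : ℂ)).indicator (isClopen_plusBd hT e)).2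

theorem zpow_horo_ter (hT : G.IsTree) (o : X) {z : ℂ} (hz : z ≠ 0) (e : DE G)
    (ω : Boundary G) :
    z ^ horo G o (ter e) ω = z⁻¹ * z ^ horo G o (ini e) ω +
      (z - z⁻¹) * (z ^ horo G o (ini e) ω * (plusBd G e).indicator 1 ω) := by
  by_cases hω : ω ∈ plusBd G e
  · rw [horo_ter_of_mem hT o hω, zpow_add_one₀ hz, Set.indicator_of_mem hω, Pi.one_apply]
    ring
  · rw [horo_ter_of_notMem hT o hω, zpow_sub_one₀ hz, Set.indicator_of_notMem hω]
    ring

theorem isLocallyConstant_zpow_horo (hT : G.IsTree) (o x : X) {z : ℂ} (hz : z ≠ 0) :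
    IsLocallyConstant fun ω : Boundary G => z ^ horo G o x ω := by
  obtain ⟨p⟩ := hT.connected x o
  induction p with
  | nil =>
    simp only [horo_self hT, zpow_zero]
    exact IsLocallyConstant.const 1
  | @cons _ _ o h p ih =>
    have hfun := funext (zpow_horo_ter hT o hz ⟨(_, _), h.symm⟩)
    dsimp only [ter, ini] at hfun
    rw [hfun]
    exact (ih.comp (z⁻¹ * ·)).add
      ((ih.mul (isLocallyConstant_indicator_plusBd hT _)).comp ((z - z⁻¹) * ·))

theorem isLocallyConstant_edgePoisson_kernel (hT : G.IsTree) (o : X) {z : ℂ} (hz : z ≠ 0)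
    (e : DE G) :
    IsLocallyConstant fun ω => z ^ horo G o (ini e) ω * (plusBd G e).indicator 1 ω :=
  (isLocallyConstant_zpow_horo hT o (ini e) hz).mul (isLocallyConstant_indicator_plusBd hT e)

theorem pairB_eq (μ : DualB G) {g : Boundary G → ℂ} (hg : IsLocallyConstant g) :
    pairB G μ g = μ ⟨g, hg⟩ := dif_pos hg

theorem pairB_linear_combination (μ : DualB G) {f g h : Boundary G → ℂ} (a b : ℂ)
    (hf : IsLocallyConstant f) (hg : IsLocallyConstant g) (h_eq : ∀ ω, h ω = a * f ω + b * g ω) :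
    pairB G μ h = a * pairB G μ f + b * pairB G μ g := by
  obtain rfl : h = fun ω => a * f ω + b * g ω := funext h_eq
  rw [pairB_eq μ (g := fun ω => a * f ω + b * g ω) ((hf.comp (a * ·)).add (hg.comp (b * ·))),
    pairB_eq μ hf, pairB_eq μ hg, ← smul_eq_mul, ← smul_eq_mul, ← map_smul, ← map_smul, ← map_add]
  rfl

theorem pairB_finset_sum (μ : DualB G) {ι : Type*} (s : Finset ι) {f : ι → Boundary G → ℂ}
    (hf : ∀ i, IsLocallyConstant (f i)) {g : Boundary G → ℂ} (hg : ∀ ω, g ω = ∑ i ∈ s, f i ω) :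
    pairB G μ g = ∑ i ∈ s, pairB G μ (f i) := by
  have hsum : g = (∑ i ∈ s, (⟨f i, hf i⟩ : Clc G) : Clc G) := by
    funext ω
    simp [hg]
  have hg' : IsLocallyConstant g := by
    rw [hsum]
    exact (∑ i ∈ s, (⟨f i, hf i⟩ : Clc G)).2
  simp only [pairB_eq μ (hf _), pairB_eq μ hg', ← map_sum]
  exact congrArg μ (Subtype.ext hsum)

theorem poisson_ter (hT : G.IsTree) (o : X) {z : ℂ} (hz : z ≠ 0) (μ : DualB G) (e : DE G) :
    poisson G o z μ (ter e) =
      z⁻¹ * poisson G o z μ (ini e) + (z - z⁻¹) * edgePoisson G o z μ e :=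
  pairB_linear_combination μ _ _ (isLocallyConstant_zpow_horo hT o (ini e) hz)
    (isLocallyConstant_edgePoisson_kernel hT o hz e) (zpow_horo_ter hT o hz e)

theorem edgePoisson_op (hT : G.IsTree) (o : X) {z : ℂ} (hz : z ≠ 0) (μ : DualB G) (e : DE G) :
    edgePoisson G o z μ (op e) =
      z⁻¹ * poisson G o z μ (ini e) - z⁻¹ * edgePoisson G o z μ e := by
  rw [sub_eq_add_neg, ← neg_mul]
  refine pairB_linear_combination μ _ _ (isLocallyConstant_zpow_horo hT o (ini e) hz)
    (isLocallyConstant_edgePoisson_kernel hT o hz e) fun ω => ?_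
  rw [show ini (op e) = ter e from rfl]
  by_cases hω : ω ∈ plusBd G e
  · rw [Set.indicator_of_notMem fun h => (mem_plusBd_op_iff hT e ω).1 h hω,
      Set.indicator_of_mem hω, Pi.one_apply]
    ring
  · rw [Set.indicator_of_mem ((mem_plusBd_op_iff hT e ω).2 hω), Set.indicator_of_notMem hω,
      horo_ter_of_notMem hT o hω, zpow_sub_one₀ hz, Pi.one_apply]
    ring

theorem edgeLap_edgePoisson (hT : G.IsTree) (hlf : LocFin G) (o : X) {z : ℂ} (hz : z ≠ 0)
    (μ : DualB G) (e : DE G) :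
    edgeLap G (edgePoisson G o z μ) e = z * edgePoisson G o z μ e := by
  have hS : {e' : DE G | ini e' = ter e ∧ e' ≠ op e}.Finite :=
    (hlf (ter e)).subset fun _ h => h.1
  have hsmul : z * edgePoisson G o z μ e =
      pairB G μ fun ω => z * (z ^ horo G o (ini e) ω * (plusBd G e).indicator 1 ω) := by
    rw [pairB_linear_combination μ z 0 (isLocallyConstant_edgePoisson_kernel hT o hz e)
      (isLocallyConstant_edgePoisson_kernel hT o hz e) (fun ω => by ring), zero_mul, add_zero,
      edgePoisson]
  rw [edgeLap, finsum_mem_eq_finite_toFinset_sum _ hS, hsmul]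
  refine (pairB_finset_sum μ _ (isLocallyConstant_edgePoisson_kernel hT o hz) fun ω => ?_).symm
  by_cases hω : ω ∈ plusBd G e
  · obtain ⟨e₁, he₁, hω₁⟩ := exists_mem_plusBd hT hω
    rw [Finset.sum_eq_single_of_mem e₁ (hS.mem_toFinset.2 he₁)]
    · rw [Set.indicator_of_mem hω, Set.indicator_of_mem hω₁, he₁.1, horo_ter_of_mem hT o hω,
        zpow_add_one₀ hz, Pi.one_apply]
      ring
    · intro e₂ he₂ hne
      have hω₂ : ω ∉ plusBd G e₂ := fun h =>
        hne (eq_of_mem_plusBd hT ((hS.mem_toFinset.1 he₂).1.trans he₁.1.symm) h hω₁)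
      rw [Set.indicator_of_notMem hω₂, mul_zero]
  · rw [Set.indicator_of_notMem hω, mul_zero, mul_zero, Finset.sum_eq_zero]
    intro e₂ he₂
    obtain ⟨hini, hne⟩ := hS.mem_toFinset.1 he₂
    rw [Set.indicator_of_notMem fun h => hω (plusBd_subset hT hini hne h), mul_zero]

theorem edgeLap_comp_ini (f : X → ℂ) {q : ℕ} (hdeg : ∀ x : X, deg G x = q + 1) (e : DE G) :
    edgeLap G (fun e' => f (ini e')) e = q * f (ter e) := by
  have hfin : {e' : DE G | ini e' = ter e}.Finite :=
    Set.finite_of_ncard_pos (by have := hdeg (ter e); rw [deg] at this; omega)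
  have hset : {e' : DE G | ini e' = ter e ∧ e' ≠ op e} = {e' | ini e' = ter e} \ {op e} := rfl
  have hcard : ({e' : DE G | ini e' = ter e ∧ e' ≠ op e}).ncard = q := by
    have hmem : op e ∈ {e' : DE G | ini e' = ter e} := rfl
    rw [hset, Set.ncard_sdiff_singleton_of_mem hmem]
    exact Nat.sub_eq_of_eq_add (hdeg (ter e))
  have hS : {e' : DE G | ini e' = ter e ∧ e' ≠ op e}.Finite := hfin.subset fun _ h => h.1
  rw [edgeLap, finsum_mem_eq_finite_toFinset_sum _ hS,
    Finset.sum_congr rfl fun e' he' => congrArg f (hS.mem_toFinset.1 he').1, Finset.sum_const,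
    ← Set.ncard_eq_toFinset_card _ hS, hcard, nsmul_eq_mul]

end BoundaryTree

/-- Action of the operators `Δᵉ` and `Ξ` on the images of the edge and
scalar Poisson transforms on a `(q+1)`-regular tree. -/
theorem statement19 {X : Type} (G : SimpleGraph X) (hT : G.IsTree) (q : ℕ) (hq : 1 ≤ q)
    (hreg : ∀ x : X, deg G x = q + 1) (o : X) (z : ℂ) (hz : z ≠ 0) (μ : DualB G) :
    (∀ e : DE G, edgeLap G (edgePoisson G o z μ) e = z * edgePoisson G o z μ e) ∧
    (∀ e : DE G, Xi G (edgePoisson G o z μ) e =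
      z⁻¹ * poisson G o z μ (ini e) - z⁻¹ * edgePoisson G o z μ e) ∧
    (∀ e : DE G, Xi G (fun e' => poisson G o z μ (ini e')) e =
      z⁻¹ * poisson G o z μ (ini e) + (z - z⁻¹) * edgePoisson G o z μ e) ∧
    (∀ e : DE G, edgeLap G (fun e' => poisson G o z μ (ini e')) e =
      (q : ℂ) * z⁻¹ * poisson G o z μ (ini e) +
        (q : ℂ) * (z - z⁻¹) * edgePoisson G o z μ e) := by
  have hlf : LocFin G := fun x => Set.finite_of_ncard_pos (by
    have := hreg x
    rw [deg] at this
    omega)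
  refine ⟨edgeLap_edgePoisson hT hlf o hz μ, edgePoisson_op hT o hz μ, poisson_ter hT o hz μ,
    fun e => ?_⟩
  rw [edgeLap_comp_ini _ hreg, poisson_ter hT o hz]
  ring

end GraphQCC
end
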